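/- The function (λ, ω) ↦ log K(λ, ω) is jointly convex on ℝ × (0, ∞). -/

import Mathlib

open MeasureTheory Real

/-- The modified Bessel function of the third kind (Watson's integral representation). -/
noncomputable def besselK (lam ω : ℝ) : ℝ :=
  ∫ t in Set.Ioi (0 : ℝ), Real.exp (-ω * Real.cosh t) * Real.cosh (lam * t)

/-- Hölder's inequality for a function dominated by a weighted geometric mean. -/
theorem integral_le_rpow_mul_rpow_of_le {α : Type*} [MeasurableSpace α] {μ : Measure α}
    {f g h : α → ℝ} {a b : ℝ} (ha : 0 ≤ a) (hb : 0 ≤ b) (hab : a + b = 1)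
    (hf : Integrable f μ) (hg : Integrable g μ) (hh : Integrable h μ)
    (hf0 : ∀ t, 0 ≤ f t) (hg0 : ∀ t, 0 ≤ g t)
    (hF : 0 < ∫ t, f t ∂μ) (hG : 0 < ∫ t, g t ∂μ)
    (hle : ∀ t, h t ≤ f t ^ a * g t ^ b) :
    ∫ t, h t ∂μ ≤ (∫ t, f t ∂μ) ^ a * (∫ t, g t ∂μ) ^ b := by
  set F := ∫ t, f t ∂μ
  set G := ∫ t, g t ∂μ
  have hC : 0 < F ^ a * G ^ b := by positivity
  have key : ∀ t, h t ≤ F ^ a * G ^ b * (a * (f t / F) + b * (g t / G)) := fun t => by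
    have amgm := Real.geom_mean_le_arith_mean2_weighted ha hb (div_nonneg (hf0 t) hF.le)
      (div_nonneg (hg0 t) hG.le) hab
    rw [Real.div_rpow (hf0 t) hF.le, Real.div_rpow (hg0 t) hG.le, div_mul_div_comm,
      div_le_iff₀' hC] at amgm
    exact (hle t).trans amgm
  have hfi : Integrable (fun t => a * (f t / F)) μ := (hf.div_const F).const_mul a
  have hgi : Integrable (fun t => b * (g t / G)) μ := (hg.div_const G).const_mul b
  calc ∫ t, h t ∂μ ≤ ∫ t, F ^ a * G ^ b * (a * (f t / F) + b * (g t / G)) ∂μ :=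
        integral_mono hh ((hfi.add hgi).const_mul _) key
    _ = F ^ a * G ^ b * (a * (F / F) + b * (G / G)) := by
        rw [integral_const_mul, integral_add hfi hgi, integral_const_mul, integral_const_mul,
          integral_div, integral_div]
    _ = F ^ a * G ^ b := by rw [div_self hF.ne', div_self hG.ne', mul_one, mul_one, hab, mul_one]

/-- Multiplicative form of the convexity of `log ∘ cosh`. -/
theorem Real.cosh_add_le_rpow_mul_rpow {a b : ℝ} (ha : 0 ≤ a) (hb : 0 ≤ b) (hab : a + b = 1)
    (x y : ℝ) : cosh (a * x + b * y) ≤ cosh x ^ a * cosh y ^ b := by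
  have hsum : ∀ z : ℝ, ∫ s : Bool, exp (if s then z else -z) ∂Measure.count = 2 * cosh z := by
    intro z
    rw [integral_count, Fintype.sum_bool, cosh_eq]
    simp only [if_true, Bool.false_eq_true, if_false]
    ring
  have h := integral_le_rpow_mul_rpow_of_le (μ := (Measure.count : Measure Bool))
    (f := fun s => exp (if s then x else -x)) (g := fun s => exp (if s then y else -y))
    (h := fun s => exp (if s then a * x + b * y else -(a * x + b * y))) ha hb hab
    .of_finite .of_finite .of_finite (fun _ => (exp_pos _).le) (fun _ => (exp_pos _).le)
    (by rw [hsum]; have := cosh_pos x; positivity)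
    (by rw [hsum]; have := cosh_pos y; positivity)
    (fun s => by
      rw [← exp_mul, ← exp_mul, ← exp_add]
      refine exp_le_exp.2 (le_of_eq ?_)
      cases s <;> simp <;> ring)
  rw [hsum, hsum, hsum, mul_rpow zero_le_two (cosh_pos x).le,
    mul_rpow zero_le_two (cosh_pos y).le, mul_mul_mul_comm, ← rpow_add zero_lt_two, hab,
    rpow_one] at h
  exact le_of_mul_le_mul_left h zero_lt_two

theorem Real.sq_div_four_le_cosh (t : ℝ) : t ^ 2 / 4 ≤ cosh t := by
  have h := quadratic_le_exp_of_nonneg (abs_nonneg t)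
  rw [sq_abs] at h
  rw [← cosh_abs, cosh_eq]
  linarith [exp_pos (-|t|), abs_nonneg t]

theorem Real.cosh_le_exp_abs (x : ℝ) : cosh x ≤ exp |x| := by
  rw [← cosh_abs, cosh_eq]
  linarith [exp_le_exp.2 (neg_le_self (abs_nonneg x))]

theorem integrable_exp_neg_mul_cosh_mul_cosh (lam : ℝ) {ω : ℝ} (hω : 0 < ω) :
    Integrable fun t => exp (-ω * cosh t) * cosh (lam * t) := by
  refine ((integrable_exp_neg_mul_sq (b := ω / 8) (by positivity)).const_mul
    (exp (2 * lam ^ 2 / ω))).mono' (by fun_prop) (.of_forall fun t => ?_)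
  rw [Real.norm_of_nonneg (mul_nonneg (exp_pos _).le (cosh_pos _).le), ← exp_add]
  refine (mul_le_mul_of_nonneg_left (cosh_le_exp_abs _) (exp_pos _).le).trans ?_
  rw [← exp_add, exp_le_exp]
  have hc := mul_le_mul_of_nonneg_left (sq_div_four_le_cosh t) hω.le
  have hl : |lam * t| ≤ 2 * lam ^ 2 / ω + ω / 8 * t ^ 2 := by
    have hsq : 2 * lam ^ 2 / ω + ω / 8 * t ^ 2 - |lam * t|
        = (4 * |lam| - ω * |t|) ^ 2 / (8 * ω) := by
      rw [abs_mul, ← sq_abs lam, ← sq_abs t]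
      field_simp
      ring
    have : 0 ≤ (4 * |lam| - ω * |t|) ^ 2 / (8 * ω) := by positivity
    linarith
  linarith

theorem besselK_pos (lam : ℝ) {ω : ℝ} (hω : 0 < ω) : 0 < besselK lam ω := by
  have hpos : ∀ t, 0 < exp (-ω * cosh t) * cosh (lam * t) :=
    fun t => mul_pos (exp_pos _) (cosh_pos _)
  rw [besselK, setIntegral_pos_iff_support_of_nonneg_ae (.of_forall fun t => (hpos t).le)
    (integrable_exp_neg_mul_cosh_mul_cosh lam hω).integrableOn,
    Function.support_eq_univ (fun t => (hpos t).ne'), Set.univ_inter, Real.volume_Ioi]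
  exact ENNReal.zero_lt_top

/-- The function `(λ, ω) ↦ log K(λ, ω)` is jointly convex on `ℝ × (0, ∞)`. -/
theorem besselK_log_convexOn :
    ConvexOn ℝ (Set.univ ×ˢ Set.Ioi (0 : ℝ))
      (fun q : ℝ × ℝ => Real.log (besselK q.1 q.2)) := by
  have hconv : Convex ℝ ((Set.univ : Set ℝ) ×ˢ Set.Ioi (0 : ℝ)) :=
    convex_univ.prod (convex_Ioi 0)
  refine ⟨hconv, ?_⟩
  rintro ⟨l, v⟩ hp ⟨m, w⟩ hq a b ha hb hab
  have hr : 0 < a * v + b * w := (hconv hp hq ha hb hab).2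
  have hv : 0 < v := hp.2
  have hw : 0 < w := hq.2
  have hK := besselK_pos l hv
  have hL := besselK_pos m hw
  have hle : besselK (a * l + b * m) (a * v + b * w) ≤ besselK l v ^ a * besselK m w ^ b := by
    refine integral_le_rpow_mul_rpow_of_le ha hb hab
      (integrable_exp_neg_mul_cosh_mul_cosh l hv).integrableOn
      (integrable_exp_neg_mul_cosh_mul_cosh m hw).integrableOn
      (integrable_exp_neg_mul_cosh_mul_cosh _ hr).integrableOn
      (fun t => mul_nonneg (exp_pos _).le (cosh_pos _).le)
      (fun t => mul_nonneg (exp_pos _).le (cosh_pos _).le) hK hL fun t => ?_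
    rw [mul_rpow (exp_pos _).le (cosh_pos _).le, mul_rpow (exp_pos _).le (cosh_pos _).le,
      mul_mul_mul_comm, ← exp_mul, ← exp_mul, ← exp_add,
      show -v * cosh t * a + -w * cosh t * b = -(a * v + b * w) * cosh t by ring,
      show (a * l + b * m) * t = a * (l * t) + b * (m * t) by ring]
    exact mul_le_mul_of_nonneg_left (cosh_add_le_rpow_mul_rpow ha hb hab _ _) (exp_pos _).le
  calc Real.log (besselK (a * l + b * m) (a * v + b * w))
      ≤ Real.log (besselK l v ^ a * besselK m w ^ b) :=
        Real.log_le_log (besselK_pos _ hr) hle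
    _ = a * Real.log (besselK l v) + b * Real.log (besselK m w) := by
        rw [Real.log_mul (rpow_pos_of_pos hK a).ne' (rpow_pos_of_pos hL b).ne',
          Real.log_rpow hK, Real.log_rpow hL]
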